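/- Pointwise weighted bound for ∂_z u^r: for every λ ∈ [0,1) there exists a constant C > 0, depending only on λ, such that for every t ≥ 0, every admissible g, every n ∈ ℕ, every multi-index α with |α| = n, and every (x,y,z) ∈ ℝ² × [0,∞): θ_λ(z) ⟨r⟩ⁿ |∂^α_h ∂_z u^r(x,y,z)| ≤ C ( (z/⟨t⟩) θ_λ(z) ⟨r⟩ⁿ |∂^α_h g(x,y,z)| + θ_λ(z) ⟨r⟩ⁿ |∂^α_h ∂_z g(x,y,z)| + (1/⟨t⟩ + z²/⟨t⟩²) θ_{λ−1}(z) ⟨t⟩^{1/4} ‖θ ⟨r⟩ⁿ ∂^α_h g(x,y,·)‖_{L²_z} ). -/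

import Mathlib

open MeasureTheory Filter Set

noncomputable section

/-- `⟨t⟩ = 1 + t` -/
def angT (t : ℝ) : ℝ := 1 + t

/-- `θ_λ(z) = exp (λ z² / (8⟨t⟩))`; `θ = θ₁`. -/
def thw (t lam z : ℝ) : ℝ := Real.exp (lam * z ^ 2 / (8 * angT t))

/-- `⟨r⟩ = √(x² + y² + 1)` -/
def angR (x y : ℝ) : ℝ := Real.sqrt (x ^ 2 + y ^ 2 + 1)

/-- `Mₙ = (n+1)⁴ / n!` -/
def Mfac (n : ℕ) : ℝ := ((n : ℝ) + 1) ^ 4 / (n.factorial : ℝ)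

/-- `∂_x` -/
def pdx (f : ℝ → ℝ → ℝ → ℝ) : ℝ → ℝ → ℝ → ℝ := fun x y z => deriv (fun x' => f x' y z) x
/-- `∂_y` -/
def pdy (f : ℝ → ℝ → ℝ → ℝ) : ℝ → ℝ → ℝ → ℝ := fun x y z => deriv (fun y' => f x y' z) y
/-- `∂_z` -/
def pdz (f : ℝ → ℝ → ℝ → ℝ) : ℝ → ℝ → ℝ → ℝ := fun x y z => deriv (fun z' => f x y z') z

/-- `∂^α_h = ∂_x^{α₁} ∂_y^{α₂}` for the multi-index `α = (a, b)` -/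
def pdh (a b : ℕ) (f : ℝ → ℝ → ℝ → ℝ) : ℝ → ℝ → ℝ → ℝ := pdx^[a] (pdy^[b] f)

/-- `r ∂_r = x ∂_x + y ∂_y` -/
def rdr (f : ℝ → ℝ → ℝ → ℝ) : ℝ → ℝ → ℝ → ℝ := fun x y z => x * pdx f x y z + y * pdy f x y z

/-- weighted `L²` norm over `ℝ² × (0,∞)` of `θ_λ ⟨r⟩ⁿ f` -/
def L2w (t lam : ℝ) (n : ℕ) (f : ℝ → ℝ → ℝ → ℝ) : ℝ :=
  Real.sqrt (∫ x : ℝ, ∫ y : ℝ, ∫ z in Ioi (0 : ℝ), (thw t lam z * angR x y ^ n * f x y z) ^ 2)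

/-- weighted `L²_z` norm at fixed `(x, y)` of `θ_λ ⟨r⟩ⁿ f (x, y, ·)` -/
def L2z (t lam : ℝ) (n : ℕ) (f : ℝ → ℝ → ℝ → ℝ) (x y : ℝ) : ℝ :=
  Real.sqrt (∫ z in Ioi (0 : ℝ), (thw t lam z * angR x y ^ n * f x y z) ^ 2)

/-- mixed `L^∞_h L²_z` norm of `θ_λ ⟨r⟩ⁿ f` -/
def LIh2z (t lam : ℝ) (n : ℕ) (f : ℝ → ℝ → ℝ → ℝ) : ℝ :=
  Real.sqrt (∫ z in Ioi (0 : ℝ), (⨆ p : ℝ × ℝ, |thw t lam z * angR p.1 p.2 ^ n * f p.1 p.2 z|) ^ 2)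

/-- mixed `L²_h L^∞_z` norm of `θ_λ ⟨r⟩ⁿ f` -/
def L2hIz (t lam : ℝ) (n : ℕ) (f : ℝ → ℝ → ℝ → ℝ) : ℝ :=
  Real.sqrt (∫ x : ℝ, ∫ y : ℝ,
    (⨆ z : Ioi (0 : ℝ), |thw t lam (z : ℝ) * angR x y ^ n * f x y (z : ℝ)|) ^ 2)

/-- the primitive `φ(x,y,z) = exp(−z²/(4⟨t⟩)) ∫₀^z g(x,y,s) exp(s²/(4⟨t⟩)) ds` -/
def phiF (t : ℝ) (g : ℝ → ℝ → ℝ → ℝ) : ℝ → ℝ → ℝ → ℝ := fun x y z =>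
  Real.exp (-(z ^ 2) / (4 * angT t)) * ∫ s in (0 : ℝ)..z, g x y s * Real.exp (s ^ 2 / (4 * angT t))

/-- `u^r = ∂_z φ` -/
def ur (t : ℝ) (g : ℝ → ℝ → ℝ → ℝ) : ℝ → ℝ → ℝ → ℝ := pdz (phiF t g)

/-- `u^z = −(x∂_x + y∂_y)φ − 2φ` -/
def uzv (t : ℝ) (g : ℝ → ℝ → ℝ → ℝ) : ℝ → ℝ → ℝ → ℝ := fun x y z =>
  -(rdr (phiF t g) x y z) - 2 * phiF t g x y z

/-- smoothness together with rapid decay in `z` of all derivatives -/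
def DecaySmooth (g : ℝ → ℝ → ℝ → ℝ) : Prop :=
  ContDiff ℝ (⊤ : ℕ∞) (fun p : ℝ × ℝ × ℝ => g p.1 p.2.1 p.2.2) ∧
  ∀ a b k m : ℕ, ∀ x y : ℝ,
    Tendsto (fun z : ℝ => z ^ m * pdz^[k] (pdh a b g) x y z) atTop (nhds 0)

/-- `θ ⟨r⟩^{|α|} ∂^α_h g ∈ L²(ℝ² × (0,∞))` for every `α` -/
def L2cond (t : ℝ) (g : ℝ → ℝ → ℝ → ℝ) : Prop :=
  ∀ a b : ℕ,
    Integrable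
      (fun p : ℝ × ℝ × ℝ =>
        (thw t 1 p.2.2 * angR p.1 p.2.1 ^ (a + b) * pdh a b g p.1 p.2.1 p.2.2) ^ 2)
      (volume.restrict {p : ℝ × ℝ × ℝ | 0 < p.2.2})

/-- `θ ⟨r⟩^{|α|} ∂^α_h ∂_z g ∈ L²(ℝ² × (0,∞))` for every `α` -/
def L2condZ (t : ℝ) (g : ℝ → ℝ → ℝ → ℝ) : Prop :=
  ∀ a b : ℕ,
    Integrable
      (fun p : ℝ × ℝ × ℝ =>
        (thw t 1 p.2.2 * angR p.1 p.2.1 ^ (a + b) * pdh a b (pdz g) p.1 p.2.1 p.2.2) ^ 2)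
      (volume.restrict {p : ℝ × ℝ × ℝ | 0 < p.2.2})

/-- `X_n(g, τ)` -/
def Xel (t τ : ℝ) (g : ℝ → ℝ → ℝ → ℝ) (n : ℕ) : ℝ :=
  (∑ a ∈ Finset.range (n + 1), L2w t 1 n (pdh a (n - a) g)) * τ ^ n * Mfac n

/-- `D_n(g, τ) = X_n(∂_z g, τ)` -/
def Del (t τ : ℝ) (g : ℝ → ℝ → ℝ → ℝ) (n : ℕ) : ℝ :=
  (∑ a ∈ Finset.range (n + 1), L2w t 1 n (pdh a (n - a) (pdz g))) * τ ^ n * Mfac n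

/-- `Y_n(g, τ)` (with `Y₀ = 0`) -/
def Yel (t τ : ℝ) (g : ℝ → ℝ → ℝ → ℝ) (n : ℕ) : ℝ :=
  (∑ a ∈ Finset.range (n + 1), L2w t 1 n (pdh a (n - a) g)) * τ ^ (n - 1) * (n : ℝ) * Mfac n

/-- `‖g‖_{X_τ}` -/
def Xnrm (t τ : ℝ) (g : ℝ → ℝ → ℝ → ℝ) : ℝ := ∑' n : ℕ, Xel t τ g n
/-- `‖g‖_{D_τ}` -/
def Dnrm (t τ : ℝ) (g : ℝ → ℝ → ℝ → ℝ) : ℝ := ∑' n : ℕ, Del t τ g n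
/-- `‖g‖_{Y_τ}` -/
def Ynrm (t τ : ℝ) (g : ℝ → ℝ → ℝ → ℝ) : ℝ := ∑' n : ℕ, Yel t τ g n

/-- triple integral over `ℝ² × (0,∞)` -/
def trip (F : ℝ → ℝ → ℝ → ℝ) : ℝ := ∫ x : ℝ, ∫ y : ℝ, ∫ z in Ioi (0 : ℝ), F x y z

/-- `I^α_1` -/
def I1 (t : ℝ) (g : ℝ → ℝ → ℝ → ℝ) (a b : ℕ) : ℝ :=
  -trip fun x y z =>
    thw t 2 z * angR x y ^ (2 * (a + b)) *
      pdh a b (fun x' y' z' => ur t g x' y' z' * rdr g x' y' z') x y z * pdh a b g x y z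

/-- `I^α_2` -/
def I2 (t : ℝ) (g : ℝ → ℝ → ℝ → ℝ) (a b : ℕ) : ℝ :=
  -trip fun x y z =>
    thw t 2 z * angR x y ^ (2 * (a + b)) *
      pdh a b (fun x' y' z' => uzv t g x' y' z' * pdz g x' y' z') x y z * pdh a b g x y z

/-- `I^α_3` -/
def I3 (t : ℝ) (g : ℝ → ℝ → ℝ → ℝ) (a b : ℕ) : ℝ :=
  -trip fun x y z =>
    thw t 2 z * angR x y ^ (2 * (a + b)) *
      pdh a b (fun x' y' z' => ur t g x' y' z' ^ 2) x y z * pdh a b g x y z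

/-- `I^α_4` -/
def I4 (t : ℝ) (g : ℝ → ℝ → ℝ → ℝ) (a b : ℕ) : ℝ :=
  (1 / (2 * angT t)) * trip fun x y z =>
    thw t 2 z * angR x y ^ (2 * (a + b)) *
      pdh a b
        (fun x' y' z' =>
          uzv t g x' y' z' * pdz (fun x'' y'' w => w * phiF t g x'' y'' w) x' y' z') x y z *
      pdh a b g x y z

/-- `I^α_5` -/
def I5 (t : ℝ) (g : ℝ → ℝ → ℝ → ℝ) (a b : ℕ) : ℝ :=
  -(1 / angT t) * trip fun x y z =>
    z * thw t 2 z * angR x y ^ (2 * (a + b)) *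
      pdh a b (fun x' y' z' => ur t g x' y' z' * phiF t g x' y' z') x y z * pdh a b g x y z

/-- `I^α_6` -/
def I6 (t : ℝ) (g : ℝ → ℝ → ℝ → ℝ) (a b : ℕ) : ℝ :=
  -(1 / (2 * angT t)) * trip fun x y z =>
    z * thw t 2 z * angR x y ^ (2 * (a + b)) *
      (∫ s in Ioi z, pdh a b (fun x' y' z' => ur t g x' y' z' ^ 2) x y s) * pdh a b g x y z

/-- `I^α_7` -/
def I7 (t : ℝ) (g : ℝ → ℝ → ℝ → ℝ) (a b : ℕ) : ℝ :=
  (1 / angT t) * trip fun x y z =>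
    z * thw t 2 z * angR x y ^ (2 * (a + b)) *
      (∫ s in Ioi z, pdh a b (fun x' y' z' => pdz (ur t g) x' y' z' * uzv t g x' y' z') x y s) *
      pdh a b g x y z

/-- `∑_{|α| = n} |I^α| τⁿ Mₙ / ‖θ ⟨r⟩ⁿ ∂^α_h g‖_{L²}` (with the convention `x / 0 = 0`) -/
def Qterm (t τ : ℝ) (g : ℝ → ℝ → ℝ → ℝ) (I : ℕ → ℕ → ℝ) (n : ℕ) : ℝ :=
  ∑ a ∈ Finset.range (n + 1), |I a (n - a)| * τ ^ n * Mfac n / L2w t 1 n (pdh a (n - a) g)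

/-- `∂_t` -/
def pdt (G : ℝ → ℝ → ℝ → ℝ → ℝ) (t x y z : ℝ) : ℝ := deriv (fun t' => G t' x y z) t

/-- the good-unknown axially symmetric Prandtl equation at the point `(t, x, y, z)` -/
def GoodEq (G : ℝ → ℝ → ℝ → ℝ → ℝ) (t x y z : ℝ) : Prop :=
  pdt G t x y z
      + ur t (G t) x y z * rdr (G t) x y z
      + uzv t (G t) x y z * pdz (G t) x y z
      - pdz (pdz (G t)) x y z
      + G t x y z / angT t
      + ur t (G t) x y z ^ 2
      - 1 / (2 * angT t) * (uzv t (G t) x y z * pdz (fun x' y' w => w * phiF t (G t) x' y' w) x y z)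
      + z / angT t * (ur t (G t) x y z * phiF t (G t) x y z)
      + z / (2 * angT t) * (∫ s in Ioi z, ur t (G t) x y s ^ 2)
      - z / angT t * (∫ s in Ioi z, pdz (ur t (G t)) x y s * uzv t (G t) x y s) = 0

/-- The uncurried form of `f` is `C^∞`. -/
def SmoothUncurried (f : ℝ → ℝ → ℝ → ℝ) : Prop :=
  ContDiff ℝ (⊤ : ℕ∞) (fun p : ℝ × ℝ × ℝ => f p.1 p.2.1 p.2.2)

namespace SmoothUncurried

variable {f : ℝ → ℝ → ℝ → ℝ}

theorem hasFDerivAt (hf : SmoothUncurried f) (p : ℝ × ℝ × ℝ) :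
    HasFDerivAt (fun p : ℝ × ℝ × ℝ => f p.1 p.2.1 p.2.2)
      (fderiv ℝ (fun p : ℝ × ℝ × ℝ => f p.1 p.2.1 p.2.2) p) p :=
  (ContDiff.differentiable hf (by simp) p).hasFDerivAt

theorem hasDerivAt_fderiv_x (hf : SmoothUncurried f) (x y z : ℝ) :
    HasDerivAt (fun x' => f x' y z)
      (fderiv ℝ (fun p : ℝ × ℝ × ℝ => f p.1 p.2.1 p.2.2) (x, y, z) (1, 0, 0)) x :=
  (hf.hasFDerivAt (x, y, z)).comp_hasDerivAt (f := fun x' : ℝ => (x', y, z)) x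
    ((hasDerivAt_id x).prodMk (hasDerivAt_const x (y, z)))

theorem hasDerivAt_x (hf : SmoothUncurried f) (x y z : ℝ) :
    HasDerivAt (fun x' => f x' y z) (pdx f x y z) x :=
  (hf.hasDerivAt_fderiv_x x y z).differentiableAt.hasDerivAt

theorem pdx_eq_fderiv (hf : SmoothUncurried f) (x y z : ℝ) :
    pdx f x y z = fderiv ℝ (fun p : ℝ × ℝ × ℝ => f p.1 p.2.1 p.2.2) (x, y, z) (1, 0, 0) :=
  (hf.hasDerivAt_fderiv_x x y z).deriv

theorem hasDerivAt_fderiv_y (hf : SmoothUncurried f) (x y z : ℝ) :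
    HasDerivAt (fun y' => f x y' z)
      (fderiv ℝ (fun p : ℝ × ℝ × ℝ => f p.1 p.2.1 p.2.2) (x, y, z) (0, 1, 0)) y :=
  (hf.hasFDerivAt (x, y, z)).comp_hasDerivAt (f := fun y' : ℝ => (x, y', z)) y
    ((hasDerivAt_const y x).prodMk ((hasDerivAt_id y).prodMk (hasDerivAt_const y z)))

theorem hasDerivAt_y (hf : SmoothUncurried f) (x y z : ℝ) :
    HasDerivAt (fun y' => f x y' z) (pdy f x y z) y :=
  (hf.hasDerivAt_fderiv_y x y z).differentiableAt.hasDerivAt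

theorem pdy_eq_fderiv (hf : SmoothUncurried f) (x y z : ℝ) :
    pdy f x y z = fderiv ℝ (fun p : ℝ × ℝ × ℝ => f p.1 p.2.1 p.2.2) (x, y, z) (0, 1, 0) :=
  (hf.hasDerivAt_fderiv_y x y z).deriv

theorem hasDerivAt_fderiv_z (hf : SmoothUncurried f) (x y z : ℝ) :
    HasDerivAt (fun z' => f x y z')
      (fderiv ℝ (fun p : ℝ × ℝ × ℝ => f p.1 p.2.1 p.2.2) (x, y, z) (0, 0, 1)) z :=
  (hf.hasFDerivAt (x, y, z)).comp_hasDerivAt (f := fun z' : ℝ => (x, y, z')) z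
    ((hasDerivAt_const z x).prodMk ((hasDerivAt_const z y).prodMk (hasDerivAt_id z)))

theorem hasDerivAt_z (hf : SmoothUncurried f) (x y z : ℝ) :
    HasDerivAt (fun z' => f x y z') (pdz f x y z) z :=
  (hf.hasDerivAt_fderiv_z x y z).differentiableAt.hasDerivAt

theorem pdz_eq_fderiv (hf : SmoothUncurried f) (x y z : ℝ) :
    pdz f x y z = fderiv ℝ (fun p : ℝ × ℝ × ℝ => f p.1 p.2.1 p.2.2) (x, y, z) (0, 0, 1) :=
  (hf.hasDerivAt_fderiv_z x y z).deriv

theorem contDiff_fderiv_apply (hf : SmoothUncurried f) (v : ℝ × ℝ × ℝ) :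
    ContDiff ℝ (⊤ : ℕ∞)
      (fun p => fderiv ℝ (fun p : ℝ × ℝ × ℝ => f p.1 p.2.1 p.2.2) p v) :=
  (ContDiff.fderiv_right (m := (⊤ : ℕ∞)) hf (by simp)).clm_apply contDiff_const

theorem pdx (hf : SmoothUncurried f) : SmoothUncurried (pdx f) := by
  simpa only [SmoothUncurried, hf.pdx_eq_fderiv] using hf.contDiff_fderiv_apply (1, 0, 0)

theorem pdy (hf : SmoothUncurried f) : SmoothUncurried (pdy f) := by
  simpa only [SmoothUncurried, hf.pdy_eq_fderiv] using hf.contDiff_fderiv_apply (0, 1, 0)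

theorem pdz (hf : SmoothUncurried f) : SmoothUncurried (pdz f) := by
  simpa only [SmoothUncurried, hf.pdz_eq_fderiv] using hf.contDiff_fderiv_apply (0, 0, 1)

theorem pdy_iterate (hf : SmoothUncurried f) (b : ℕ) : SmoothUncurried (_root_.pdy^[b] f) := by
  induction b with
  | zero => exact hf
  | succ b ih => rw [Function.iterate_succ_apply']; exact ih.pdy

theorem pdx_iterate (hf : SmoothUncurried f) (a : ℕ) : SmoothUncurried (_root_.pdx^[a] f) := by
  induction a with
  | zero => exact hf
  | succ a ih => rw [Function.iterate_succ_apply']; exact ih.pdx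

theorem pdh (hf : SmoothUncurried f) (a b : ℕ) : SmoothUncurried (pdh a b f) :=
  (hf.pdy_iterate b).pdx_iterate a

theorem pdy_pdx_comm (hf : SmoothUncurried f) :
    _root_.pdy (_root_.pdx f) = _root_.pdx (_root_.pdy f) := by
  funext x y z
  have hd : DifferentiableAt ℝ
      (fderiv ℝ (fun p : ℝ × ℝ × ℝ => f p.1 p.2.1 p.2.2)) (x, y, z) :=
    (ContDiff.fderiv_right (m := (⊤ : ℕ∞)) hf (by simp)).differentiable (by simp) _
  rw [hf.pdx.pdy_eq_fderiv, hf.pdy.pdx_eq_fderiv]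
  simp only [hf.pdx_eq_fderiv, hf.pdy_eq_fderiv, Prod.mk.eta]
  rw [fderiv_clm_apply hd (differentiableAt_const _),
    fderiv_clm_apply hd (differentiableAt_const _)]
  simpa using (ContDiff.contDiffAt hf).isSymmSndFDerivAt
      (by simpa using WithTop.coe_le_coe.2 (le_top : (2 : ℕ∞) ≤ ⊤)) (0, 1, 0) (1, 0, 0)

theorem pdy_pdx_iterate_comm (hf : SmoothUncurried f) (a : ℕ) :
    _root_.pdy (_root_.pdx^[a] f) = _root_.pdx^[a] (_root_.pdy f) := by
  induction a with
  | zero => rfl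
  | succ a ih =>
    rw [Function.iterate_succ_apply', Function.iterate_succ_apply', (hf.pdx_iterate a).pdy_pdx_comm,
      ih]

theorem pdy_pdh (hf : SmoothUncurried f) (a b : ℕ) :
    _root_.pdy (_root_.pdh a b f) = _root_.pdh a (b + 1) f := by
  rw [_root_.pdh, _root_.pdh, (hf.pdy_iterate b).pdy_pdx_iterate_comm, Function.iterate_succ_apply']

theorem continuous_z (hf : SmoothUncurried f) (x y : ℝ) : Continuous (f x y) :=
  (ContDiff.continuous hf).comp (f := fun z : ℝ => (x, y, z)) (by fun_prop)

end SmoothUncurried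

theorem pdx_pdh (a b : ℕ) (f : ℝ → ℝ → ℝ → ℝ) : pdx (pdh a b f) = pdh (a + 1) b f := by
  rw [pdh, pdh, Function.iterate_succ_apply']

/-- Differentiation under the integral sign for a `C¹` integrand over a compact interval. -/
theorem hasDerivAt_intervalIntegral_of_continuous {F F' : ℝ → ℝ → ℝ}
    (hF : ∀ x s, HasDerivAt (fun x => F x s) (F' x s) x)
    (hFc : ∀ x, Continuous (F x)) (hF'c : Continuous (fun p : ℝ × ℝ => F' p.1 p.2)) (a b x : ℝ) :
    HasDerivAt (fun x => ∫ s in a..b, F x s) (∫ s in a..b, F' x s) x := by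
  obtain ⟨M, hM⟩ := ((isCompact_closedBall x 1).prod (isCompact_uIcc (a := a) (b := b))
    ).exists_bound_of_continuousOn hF'c.continuousOn
  have hF'x : Continuous (F' x) := hF'c.comp (f := fun s : ℝ => (x, s)) (by fun_prop)
  refine (intervalIntegral.hasDerivAt_integral_of_dominated_loc_of_deriv_le (F := F) (F' := F')
    (bound := fun _ => M) (Metric.closedBall_mem_nhds x one_pos)
    (Eventually.of_forall fun x' => (hFc x').aestronglyMeasurable)
    ((hFc x).intervalIntegrable _ _) hF'x.aestronglyMeasurable
    (Eventually.of_forall fun s hs x' hx' => hM (x', s) ⟨hx', uIoc_subset_uIcc hs⟩)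
    intervalIntegrable_const (Eventually.of_forall fun s _ x' _ => hF x' s)).2

theorem SmoothUncurried.hasDerivAt_phiF_x {g : ℝ → ℝ → ℝ → ℝ} (hg : SmoothUncurried g)
    (t x y z : ℝ) :
    HasDerivAt (fun x' => phiF t g x' y z) (phiF t (_root_.pdx g) x y z) x := by
  have hc := ContDiff.continuous hg.pdx
  refine (hasDerivAt_intervalIntegral_of_continuous
    (F := fun x' s => g x' y s * Real.exp (s ^ 2 / (4 * angT t)))
    (F' := fun x' s => _root_.pdx g x' y s * Real.exp (s ^ 2 / (4 * angT t)))
    (fun x' s => (hg.hasDerivAt_x x' y s).mul_const _)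
    (fun x' => (hg.continuous_z x' y).mul (by fun_prop)) ?_ 0 z x).const_mul _
  exact (hc.comp (f := fun p : ℝ × ℝ => (p.1, y, p.2)) (by fun_prop)).mul (by fun_prop)

theorem SmoothUncurried.hasDerivAt_phiF_y {g : ℝ → ℝ → ℝ → ℝ} (hg : SmoothUncurried g)
    (t x y z : ℝ) :
    HasDerivAt (fun y' => phiF t g x y' z) (phiF t (_root_.pdy g) x y z) y := by
  have hc := ContDiff.continuous hg.pdy
  refine (hasDerivAt_intervalIntegral_of_continuous
    (F := fun y' s => g x y' s * Real.exp (s ^ 2 / (4 * angT t)))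
    (F' := fun y' s => _root_.pdy g x y' s * Real.exp (s ^ 2 / (4 * angT t)))
    (fun y' s => (hg.hasDerivAt_y x y' s).mul_const _)
    (fun y' => (hg.continuous_z x y').mul (by fun_prop)) ?_ 0 z y).const_mul _
  exact (hc.comp (f := fun p : ℝ × ℝ => (x, p.1, p.2)) (by fun_prop)).mul (by fun_prop)

theorem SmoothUncurried.hasDerivAt_phiF_z {g : ℝ → ℝ → ℝ → ℝ} (hg : SmoothUncurried g)
    (t x y z : ℝ) :
    HasDerivAt (fun z' => phiF t g x y z') (g x y z - z / (2 * angT t) * phiF t g x y z) z := by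
  have hc : Continuous fun s => g x y s * Real.exp (s ^ 2 / (4 * angT t)) :=
    (hg.continuous_z x y).mul (by fun_prop)
  have h1 := intervalIntegral.integral_hasDerivAt_right (hc.intervalIntegrable 0 z)
    (hc.stronglyMeasurableAtFilter _ _) hc.continuousAt
  have h2 : HasDerivAt (fun z' : ℝ => Real.exp (-(z' ^ 2) / (4 * angT t)))
      (Real.exp (-(z ^ 2) / (4 * angT t)) * (-(2 * z) / (4 * angT t))) z := by
    simpa using (((hasDerivAt_pow 2 z).neg).div_const (4 * angT t)).exp
  refine (h2.mul h1).congr_deriv ?_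
  have h3 : Real.exp (-(z ^ 2) / (4 * angT t)) * Real.exp (z ^ 2 / (4 * angT t)) = 1 := by
    rw [← Real.exp_add, neg_div, neg_add_cancel, Real.exp_zero]
  have h4 : -(2 * z) / (4 * angT t) = -(z / (2 * angT t)) := by
    rw [show 4 * angT t = 2 * (2 * angT t) by ring, neg_div, mul_div_mul_left _ _ two_ne_zero]
  rw [h4, phiF]
  linear_combination g x y z * h3

theorem SmoothUncurried.ur_eq {g : ℝ → ℝ → ℝ → ℝ} (hg : SmoothUncurried g) (t : ℝ) :
    ur t g = fun x y z => g x y z - z / (2 * angT t) * phiF t g x y z := by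
  funext x y z
  exact (hg.hasDerivAt_phiF_z t x y z).deriv

theorem SmoothUncurried.pdz_ur {g : ℝ → ℝ → ℝ → ℝ} (hg : SmoothUncurried g) (t : ℝ) :
    _root_.pdz (ur t g) = fun x y z => _root_.pdz g x y z + (-(z / (2 * angT t))) * g x y z +
      ((z / (2 * angT t)) ^ 2 - 1 / (2 * angT t)) * phiF t g x y z := by
  funext x y z
  rw [hg.ur_eq]
  have h := (hg.hasDerivAt_z x y z).sub
    (((hasDerivAt_id z).div_const (2 * angT t)).mul (hg.hasDerivAt_phiF_z t x y z))
  refine h.deriv.trans ?_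
  simp only [id]
  ring

theorem pdh_add_phiF {A B : ℝ → ℝ → ℝ → ℝ} (hA : SmoothUncurried A) (hB : SmoothUncurried B)
    (t : ℝ) (c d : ℝ → ℝ) (a b : ℕ) :
    pdh a b (fun x y z => A x y z + c z * B x y z + d z * phiF t B x y z) =
      fun x y z => pdh a b A x y z + c z * pdh a b B x y z + d z * phiF t (pdh a b B) x y z := by
  have hy : pdy^[b] (fun x y z => A x y z + c z * B x y z + d z * phiF t B x y z) =
      fun x y z => pdy^[b] A x y z + c z * pdy^[b] B x y z + d z * phiF t (pdy^[b] B) x y z := by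
    induction b with
    | zero => rfl
    | succ b ih =>
      simp only [Function.iterate_succ_apply', ih]
      funext x y z
      exact ((((hA.pdy_iterate b).hasDerivAt_y x y z).add
        (((hB.pdy_iterate b).hasDerivAt_y x y z).const_mul _)).add
        (((hB.pdy_iterate b).hasDerivAt_phiF_y t x y z).const_mul _)).deriv
  simp only [pdh, hy]
  induction a with
  | zero => rfl
  | succ a ih =>
    simp only [Function.iterate_succ_apply', ih]
    funext x y z
    exact (((((hA.pdy_iterate b).pdx_iterate a).hasDerivAt_x x y z).add
      ((((hB.pdy_iterate b).pdx_iterate a).hasDerivAt_x x y z).const_mul _)).add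
      ((((hB.pdy_iterate b).pdx_iterate a).hasDerivAt_phiF_x t x y z).const_mul _)).deriv

/-- One-dimensional Sobolev inequality on a unit interval. -/
theorem sq_le_intervalIntegral_sq_add_sq_deriv {f f' : ℝ → ℝ} (hf : ∀ s, HasDerivAt f (f' s) s)
    (hf' : Continuous f') (c : ℝ) :
    f c ^ 2 ≤ ∫ s in c..c + 1, 2 * (f s ^ 2 + f' s ^ 2) := by
  have hfc : Continuous f := continuous_iff_continuousAt.2 fun s => (hf s).continuousAt
  have hd (s : ℝ) : HasDerivAt (fun s => (s - c - 1) * f s ^ 2)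
      (f s ^ 2 + (s - c - 1) * (2 * f s * f' s)) s := by
    have h := (((hasDerivAt_id s).sub_const c).sub_const 1).mul ((hf s).pow 2)
    refine h.congr_deriv ?_
    simp
  have hcont : Continuous fun s => f s ^ 2 + (s - c - 1) * (2 * f s * f' s) := by fun_prop
  have h := intervalIntegral.integral_eq_sub_of_hasDerivAt (fun s _ => hd s)
    (hcont.intervalIntegrable c (c + 1))
  have h' : f c ^ 2 = ∫ s in c..c + 1, (f s ^ 2 + (s - c - 1) * (2 * f s * f' s)) := by
    rw [h]; ring
  rw [h']
  refine intervalIntegral.integral_mono_on (by linarith) (hcont.intervalIntegrable _ _)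
    (Continuous.intervalIntegrable (by fun_prop) _ _) fun s hs => ?_
  have h1 : 0 ≤ s - c := by linarith [hs.1]
  have h2 : 0 ≤ 1 - (s - c) := by linarith [hs.2]
  nlinarith [mul_nonneg h2 (sq_nonneg (f s + f' s)), mul_nonneg h1 (sq_nonneg (f s)),
    mul_nonneg h1 (sq_nonneg (f' s)), sq_nonneg (f' s)]

theorem ofReal_sq_le_lintegral_sq_add_sq_deriv {f f' : ℝ → ℝ} (hf : ∀ s, HasDerivAt f (f' s) s)
    (hf' : Continuous f') (c : ℝ) :
    ENNReal.ofReal (f c ^ 2) ≤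
      2 * ∫⁻ s, (ENNReal.ofReal (f s ^ 2) + ENNReal.ofReal (f' s ^ 2)) := by
  have hfc : Continuous f := continuous_iff_continuousAt.2 fun s => (hf s).continuousAt
  have hcont : Continuous fun s => 2 * (f s ^ 2 + f' s ^ 2) := by fun_prop
  refine (ENNReal.ofReal_le_ofReal (sq_le_intervalIntegral_sq_add_sq_deriv hf hf' c)).trans ?_
  rw [intervalIntegral.integral_of_le (by linarith), ofReal_integral_eq_lintegral_ofReal
    ((intervalIntegrable_iff_integrableOn_Ioc_of_le (by linarith)).1
      (hcont.intervalIntegrable c (c + 1)))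
    (Eventually.of_forall fun s => by positivity)]
  refine (setLIntegral_le_lintegral _ _).trans ?_
  rw [← lintegral_const_mul' _ _ (by simp)]
  refine lintegral_mono fun s => le_of_eq ?_
  rw [ENNReal.ofReal_mul zero_le_two, ENNReal.ofReal_add (sq_nonneg _) (sq_nonneg _)]
  simp

namespace SmoothUncurried

variable {h : ℝ → ℝ → ℝ → ℝ}

/-- Two-dimensional Sobolev inequality in the horizontal variables. -/
theorem ofReal_sq_le_lintegral_lintegral (hh : SmoothUncurried h) (x y z : ℝ) :
    ENNReal.ofReal (h x y z ^ 2) ≤ 4 * ∫⁻ s, ∫⁻ r,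
      (ENNReal.ofReal (h s r z ^ 2) + ENNReal.ofReal (_root_.pdy h s r z ^ 2) +
        (ENNReal.ofReal (_root_.pdx h s r z ^ 2) +
          ENNReal.ofReal (_root_.pdy (_root_.pdx h) s r z ^ 2))) := by
  have hx := ContDiff.continuous hh.pdx
  have hy := ContDiff.continuous hh.pdy
  have hxy := ContDiff.continuous hh.pdx.pdy
  have hc := ContDiff.continuous hh
  refine (ofReal_sq_le_lintegral_sq_add_sq_deriv (fun s => hh.hasDerivAt_x s y z)
    (hx.comp (f := fun s : ℝ => (s, y, z)) (by fun_prop)) x).trans ?_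
  rw [show (4 : ENNReal) = 2 * 2 by norm_num, mul_assoc]
  refine mul_le_mul_right ?_ 2
  rw [← lintegral_const_mul' 2 _ (by simp)]
  refine lintegral_mono fun s => ?_
  have m1 : Continuous fun r => h s r z := hc.comp (f := fun r : ℝ => (s, r, z)) (by fun_prop)
  have m2 : Continuous fun r => _root_.pdy h s r z :=
    hy.comp (f := fun r : ℝ => (s, r, z)) (by fun_prop)
  have m : Measurable fun r => ENNReal.ofReal (h s r z ^ 2) +
      ENNReal.ofReal (_root_.pdy h s r z ^ 2) :=
    (m1.pow 2).measurable.ennreal_ofReal.add (m2.pow 2).measurable.ennreal_ofReal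
  rw [lintegral_add_left m, mul_add]
  exact add_le_add
    (ofReal_sq_le_lintegral_sq_add_sq_deriv (fun r => hh.hasDerivAt_y s r z) m2 y)
    (ofReal_sq_le_lintegral_sq_add_sq_deriv (fun r => hh.pdx.hasDerivAt_y s r z)
      (hxy.comp (f := fun r : ℝ => (s, r, z)) (by fun_prop)) y)

end SmoothUncurried

/-- Tonelli's theorem moving the vertical variable outermost. -/
theorem lintegral_lintegral_lintegral_eq {W : ℝ × ℝ × ℝ → ENNReal} (hW : Measurable W) :
    ∫⁻ z in Ioi (0 : ℝ), ∫⁻ x, ∫⁻ y, W (x, y, z) =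
      ∫⁻ p in {p : ℝ × ℝ × ℝ | 0 < p.2.2}, W p := by
  have hset : {p : ℝ × ℝ × ℝ | 0 < p.2.2} = univ ×ˢ (univ ×ˢ Ioi (0 : ℝ)) := by
    ext p; simp
  rw [hset, Measure.volume_eq_prod, ← Measure.prod_restrict, Measure.volume_eq_prod,
    ← Measure.prod_restrict, Measure.restrict_univ, lintegral_prod _ hW.aemeasurable]
  have h1 : Measurable fun q : ℝ × ℝ => ∫⁻ y, W (q.2, y, q.1) :=
    Measurable.lintegral_prod_right' (f := fun q : (ℝ × ℝ) × ℝ => W (q.1.2, q.2, q.1.1))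
      (hW.comp (by fun_prop))
  rw [lintegral_lintegral_swap (f := fun z x => ∫⁻ y, W (x, y, z)) h1.aemeasurable]
  refine lintegral_congr fun x => ?_
  have h2 : Measurable fun q : ℝ × ℝ => W (x, q.2, q.1) := hW.comp (by fun_prop)
  rw [lintegral_lintegral_swap (f := fun z y => W (x, y, z)) h2.aemeasurable,
    lintegral_prod (fun q => W (x, q)) (hW.comp (by fun_prop)).aemeasurable]

theorem continuous_thw (t lam : ℝ) : Continuous (thw t lam) := by
  unfold thw; fun_prop

theorem one_le_angR (x y : ℝ) : 1 ≤ angR x y :=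
  Real.one_le_sqrt.2 (by nlinarith [sq_nonneg x, sq_nonneg y])

/-- The slice at every `(x, y)` (not just almost every) is square integrable, by Sobolev embedding
in the horizontal variables. -/
theorem L2cond.integrableOn_slice {t : ℝ} {g : ℝ → ℝ → ℝ → ℝ} (hg : SmoothUncurried g)
    (hL : L2cond t g) (a b : ℕ) (x y : ℝ) :
    IntegrableOn (fun z => (thw t 1 z * pdh a b g x y z) ^ 2) (Ioi 0) := by
  have hcont (i j : ℕ) : Continuous fun p : ℝ × ℝ × ℝ =>
      (thw t 1 p.2.2 * pdh i j g p.1 p.2.1 p.2.2) ^ 2 := by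
    have h1 := ContDiff.continuous (hg.pdh i j)
    have h2 := continuous_thw t 1
    fun_prop
  have hfin (i j : ℕ) : ∫⁻ p in {p : ℝ × ℝ × ℝ | 0 < p.2.2},
      ENNReal.ofReal ((thw t 1 p.2.2 * pdh i j g p.1 p.2.1 p.2.2) ^ 2) < ⊤ := by
    refine lt_of_le_of_lt (lintegral_mono fun p => ENNReal.ofReal_le_ofReal ?_)
      (hL i j).lintegral_lt_top
    have h1 : 1 ≤ (angR p.1 p.2.1 ^ (i + j)) ^ 2 := one_le_pow₀ (one_le_pow₀ (one_le_angR _ _))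
    have h2 := sq_nonneg (thw t 1 p.2.2 * pdh i j g p.1 p.2.1 p.2.2)
    calc _ ≤ (angR p.1 p.2.1 ^ (i + j)) ^ 2 *
          (thw t 1 p.2.2 * pdh i j g p.1 p.2.1 p.2.2) ^ 2 := le_mul_of_one_le_left h2 h1
      _ = _ := by ring
  have hmeas (i j : ℕ) : Measurable fun p : ℝ × ℝ × ℝ =>
      ENNReal.ofReal ((thw t 1 p.2.2 * pdh i j g p.1 p.2.1 p.2.2) ^ 2) :=
    (hcont i j).measurable.ennreal_ofReal
  set W : ℝ × ℝ × ℝ → ENNReal := fun p =>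
    ENNReal.ofReal ((thw t 1 p.2.2 * pdh a b g p.1 p.2.1 p.2.2) ^ 2) +
      ENNReal.ofReal ((thw t 1 p.2.2 * pdh a (b + 1) g p.1 p.2.1 p.2.2) ^ 2) +
      (ENNReal.ofReal ((thw t 1 p.2.2 * pdh (a + 1) b g p.1 p.2.1 p.2.2) ^ 2) +
        ENNReal.ofReal ((thw t 1 p.2.2 * pdh (a + 1) (b + 1) g p.1 p.2.1 p.2.2) ^ 2)) with hWdef
  have hW : Measurable W :=
    ((hmeas _ _).add (hmeas _ _)).add ((hmeas _ _).add (hmeas _ _))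
  have hWfin : ∫⁻ p in {p : ℝ × ℝ × ℝ | 0 < p.2.2}, W p < ⊤ := by
    refine (lintegral_add_left ((hmeas _ _).add (hmeas _ _)) _).trans_lt
      (ENNReal.add_lt_top.2 ⟨?_, ?_⟩)
    all_goals
      exact (lintegral_add_left (hmeas _ _) _).trans_lt
        (ENNReal.add_lt_top.2 ⟨hfin _ _, hfin _ _⟩)
  have hle (z : ℝ) : ENNReal.ofReal ((thw t 1 z * pdh a b g x y z) ^ 2) ≤
      4 * ∫⁻ s, ∫⁻ r, W (s, r, z) := by
    have h := (hg.pdh a b).ofReal_sq_le_lintegral_lintegral x y z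
    rw [pdx_pdh, hg.pdy_pdh, hg.pdy_pdh] at h
    simp only [hWdef, mul_pow, ENNReal.ofReal_mul (sq_nonneg (thw t 1 z)), ← mul_add]
    simp only [lintegral_const_mul' _ _ ENNReal.ofReal_ne_top]
    rw [mul_left_comm]
    exact mul_le_mul_right h _
  refine ⟨((hcont a b).comp (f := fun z : ℝ => (x, y, z)) (by fun_prop)).aestronglyMeasurable, ?_⟩
  rw [hasFiniteIntegral_iff_ofReal (Eventually.of_forall fun z => sq_nonneg _)]
  refine (lintegral_mono hle).trans_lt ?_
  rw [lintegral_const_mul' _ _ (by simp), lintegral_lintegral_lintegral_eq hW]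
  exact ENNReal.mul_lt_top (by simp) hWfin

/-- Cauchy–Schwarz inequality for continuous functions on a compact interval. -/
theorem sq_intervalIntegral_mul_le {u v : ℝ → ℝ} (hu : Continuous u) (hv : Continuous v)
    {a b : ℝ} (hab : a ≤ b) :
    (∫ s in a..b, u s * v s) ^ 2 ≤ (∫ s in a..b, u s ^ 2) * ∫ s in a..b, v s ^ 2 := by
  have h (k : ℝ) : 0 ≤ (∫ s in a..b, v s ^ 2) * (k * k) + (2 * ∫ s in a..b, u s * v s) * k +
      ∫ s in a..b, u s ^ 2 := by
    have i1 : IntervalIntegrable (fun s => v s ^ 2 * (k * k)) volume a b :=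
      Continuous.intervalIntegrable (by fun_prop) _ _
    have i2 : IntervalIntegrable (fun s => 2 * (u s * v s) * k) volume a b :=
      Continuous.intervalIntegrable (by fun_prop) _ _
    have i3 : IntervalIntegrable (fun s => u s ^ 2) volume a b :=
      Continuous.intervalIntegrable (by fun_prop) _ _
    rw [← intervalIntegral.integral_mul_const, ← intervalIntegral.integral_const_mul,
      ← intervalIntegral.integral_mul_const, ← intervalIntegral.integral_add i1 i2,
      ← intervalIntegral.integral_add (i1.add i2) i3]
    refine intervalIntegral.integral_nonneg hab fun s _ => ?_
    nlinarith [sq_nonneg (k * v s + u s)]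
  have := discrim_le_zero h
  rw [discrim] at this
  nlinarith

theorem intervalIntegral_exp_sq_sub_sq_le {T z : ℝ} (hT : 0 < T) (hz : 0 ≤ z) :
    ∫ s in (0 : ℝ)..z, Real.exp ((s ^ 2 - z ^ 2) / (4 * T)) ≤ 2 * √T := by
  have hb : 0 < 1 / (4 * T) := by positivity
  calc ∫ s in (0 : ℝ)..z, Real.exp ((s ^ 2 - z ^ 2) / (4 * T))
      ≤ ∫ s in (0 : ℝ)..z, Real.exp (-(1 / (4 * T)) * (z - s) ^ 2) := by
        refine intervalIntegral.integral_mono_on hz (Continuous.intervalIntegrable (by fun_prop) _ _)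
          (Continuous.intervalIntegrable (by fun_prop) _ _) fun s hs => ?_
        rw [Real.exp_le_exp, neg_mul, one_div_mul_eq_div, ← neg_div]
        gcongr
        nlinarith [mul_nonneg hs.1 (sub_nonneg.2 hs.2)]
    _ = ∫ w in (0 : ℝ)..z, Real.exp (-(1 / (4 * T)) * w ^ 2) := by
        rw [intervalIntegral.integral_comp_sub_left
          (fun w => Real.exp (-(1 / (4 * T)) * w ^ 2)) z]
        simp
    _ ≤ ∫ w in Ioi (0 : ℝ), Real.exp (-(1 / (4 * T)) * w ^ 2) := by
        rw [intervalIntegral.integral_of_le hz]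
        exact setIntegral_mono_set (integrable_exp_neg_mul_sq hb).integrableOn
          (Eventually.of_forall fun w => (Real.exp_pos _).le) Ioc_subset_Ioi_self.eventuallyLE
    _ = √(Real.pi / (1 / (4 * T))) / 2 := integral_gaussian_Ioi _
    _ ≤ √(4 ^ 2 * T) / 2 := by
        gcongr
        rw [div_div_eq_mul_div, div_one]
        nlinarith [Real.pi_le_four]
    _ = 2 * √T := by
        rw [Real.sqrt_mul (by positivity), Real.sqrt_sq (by norm_num)]
        ring

/-- Pointwise bound of the primitive `φ` by the weighted `L²` norm of `g`. -/
theorem abs_phiF_le {t : ℝ} (hT : 0 < angT t) {g : ℝ → ℝ → ℝ → ℝ} {x y z : ℝ}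
    (hc : Continuous (g x y)) (hi : IntegrableOn (fun s => (thw t 1 s * g x y s) ^ 2) (Ioi 0))
    (hz : 0 ≤ z) :
    |phiF t g x y z| ≤ 2 * (thw t (-1) z * angT t ^ ((1 : ℝ) / 4) *
      √(∫ s in Ioi 0, (thw t 1 s * g x y s) ^ 2)) := by
  have hθ := continuous_thw t 1
  have hI0 : 0 ≤ ∫ s in Ioi 0, (thw t 1 s * g x y s) ^ 2 := integral_nonneg fun s => sq_nonneg _
  have hN : ∫ s in (0 : ℝ)..z, (thw t 1 s * g x y s) ^ 2 ≤
      ∫ s in Ioi 0, (thw t 1 s * g x y s) ^ 2 := by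
    rw [intervalIntegral.integral_of_le hz]
    exact setIntegral_mono_set hi (Eventually.of_forall fun s => sq_nonneg _)
      Ioc_subset_Ioi_self.eventuallyLE
  have hsplit : ∫ s in (0 : ℝ)..z, g x y s * Real.exp (s ^ 2 / (4 * angT t)) =
      ∫ s in (0 : ℝ)..z, thw t 1 s * g x y s * thw t 1 s := by
    congr 1 with s
    rw [show s ^ 2 / (4 * angT t) = 1 * s ^ 2 / (8 * angT t) + 1 * s ^ 2 / (8 * angT t) by
      field_simp; ring, Real.exp_add, thw]
    ring
  have hcs := sq_intervalIntegral_mul_le (u := fun s => thw t 1 s * g x y s) (hθ.mul hc) hθ hz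
  have hgauss : Real.exp (-(z ^ 2) / (4 * angT t)) * ∫ s in (0 : ℝ)..z, thw t 1 s ^ 2 ≤
      2 * √(angT t) := by
    rw [← intervalIntegral.integral_const_mul]
    refine le_of_eq_of_le (intervalIntegral.integral_congr fun s _ => ?_)
      (intervalIntegral_exp_sq_sub_sq_le hT hz)
    rw [thw, ← Real.exp_nat_mul, ← Real.exp_add]
    congr 1
    push_cast
    field_simp
    ring
  have hE : Real.exp (-(z ^ 2) / (4 * angT t)) = thw t (-1) z ^ 2 := by
    rw [thw, ← Real.exp_nat_mul]
    congr 1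
    push_cast
    field_simp
    ring
  have hq : (angT t ^ ((1 : ℝ) / 4)) ^ 2 = √(angT t) := by
    rw [← Real.rpow_natCast, ← Real.rpow_mul hT.le, Real.sqrt_eq_rpow]
    norm_num
  refine abs_le_of_sq_le_sq ?_ (mul_nonneg zero_le_two (mul_nonneg (mul_nonneg
    (Real.exp_pos _).le (Real.rpow_nonneg hT.le _)) (Real.sqrt_nonneg _)))
  rw [mul_pow, mul_pow, mul_pow, Real.sq_sqrt hI0, hq, ← hE, phiF, mul_pow, hsplit]
  set e := Real.exp (-(z ^ 2) / (4 * angT t))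
  have he : 0 ≤ e := (Real.exp_pos _).le
  set I := ∫ s in Ioi 0, (thw t 1 s * g x y s) ^ 2
  calc e ^ 2 * (∫ s in (0 : ℝ)..z, thw t 1 s * g x y s * thw t 1 s) ^ 2
      ≤ e ^ 2 * (I * ∫ s in (0 : ℝ)..z, thw t 1 s ^ 2) := by
        gcongr
        exact hcs.trans (mul_le_mul_of_nonneg_right hN
          (intervalIntegral.integral_nonneg hz fun s _ => sq_nonneg _))
    _ = e * I * (e * ∫ s in (0 : ℝ)..z, thw t 1 s ^ 2) := by ring
    _ ≤ e * I * (2 * √(angT t)) := by gcongr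
    _ ≤ 2 ^ 2 * (e * √(angT t) * I) := by
        nlinarith [mul_nonneg (mul_nonneg he hI0) (Real.sqrt_nonneg (angT t))]

theorem L2z_eq_angR_pow_mul (t : ℝ) (n : ℕ) (f : ℝ → ℝ → ℝ → ℝ) (x y : ℝ) :
    L2z t 1 n f x y = angR x y ^ n * √(∫ z in Ioi 0, (thw t 1 z * f x y z) ^ 2) := by
  have h : 0 ≤ angR x y ^ n := pow_nonneg (Real.sqrt_nonneg _) _
  have e (z : ℝ) : (thw t 1 z * angR x y ^ n * f x y z) ^ 2 =
      (angR x y ^ n) ^ 2 * (thw t 1 z * f x y z) ^ 2 := by ring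
  simp only [L2z, e]
  rw [integral_const_mul, Real.sqrt_mul (sq_nonneg _), Real.sqrt_sq h]

/-- pointwise weighted bound for `∂_z u^r`. -/
theorem pointwise_bound_dz_ur :
    ∀ lam : ℝ, 0 ≤ lam → lam < 1 → ∃ C : ℝ, 0 < C ∧
      ∀ t : ℝ, 0 ≤ t → ∀ g : ℝ → ℝ → ℝ → ℝ, DecaySmooth g → L2cond t g → L2condZ t g →
        ∀ n a b : ℕ, a + b = n → ∀ x y z : ℝ, 0 ≤ z →
          thw t lam z * angR x y ^ n * |pdh a b (pdz (ur t g)) x y z| ≤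
            C * (z / angT t * (thw t lam z * angR x y ^ n * |pdh a b g x y z|) +
              thw t lam z * angR x y ^ n * |pdh a b (pdz g) x y z| +
              (1 / angT t + z ^ 2 / angT t ^ 2) * thw t (lam - 1) z * angT t ^ ((1 : ℝ) / 4) *
                L2z t 1 n (pdh a b g) x y) := by
  intro lam _ _
  refine ⟨1, one_pos, ?_⟩
  rintro t ht g ⟨hg, -⟩ hL - n a b rfl x y z hz
  replace hg : SmoothUncurried g := hg
  have hT : 0 < angT t := by unfold angT; linarith
  rw [hg.pdz_ur t, pdh_add_phiF hg.pdz hg t (fun z => -(z / (2 * angT t)))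
    (fun z => (z / (2 * angT t)) ^ 2 - 1 / (2 * angT t)) a b, L2z_eq_angR_pow_mul, one_mul]
  have hphi := abs_phiF_le hT ((hg.pdh a b).continuous_z x y) (hL.integrableOn_slice hg a b x y) hz
  have hth : thw t (lam - 1) z = thw t lam z * thw t (-1) z := by
    unfold thw
    rw [← Real.exp_add]
    ring_nf
  rw [hth]
  have hK : 0 ≤ thw t lam z * angR x y ^ (a + b) :=
    mul_nonneg (Real.exp_pos _).le (pow_nonneg (Real.sqrt_nonneg _) _)
  set A := pdh a b (pdz g) x y z
  set B := pdh a b g x y z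
  set φ := phiF t (pdh a b g) x y z
  set N := √(∫ s in Ioi 0, (thw t 1 s * pdh a b g x y s) ^ 2)
  set E := thw t (-1) z
  set q := angT t ^ ((1 : ℝ) / 4)
  have hw : 0 ≤ z / angT t := by positivity
  have hi : 0 ≤ 1 / angT t := by positivity
  have hcoef : |(z / (2 * angT t)) ^ 2 - 1 / (2 * angT t)| ≤
      (1 / angT t + z ^ 2 / angT t ^ 2) / 2 := by
    have e1 : z / (2 * angT t) = z / angT t / 2 := by field_simp
    have e2 : 1 / (2 * angT t) = 1 / angT t / 2 := by field_simp
    rw [e1, e2, ← div_pow, abs_le]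
    constructor <;> nlinarith [sq_nonneg (z / angT t)]
  have hmid : |-(z / (2 * angT t)) * B| ≤ z / angT t * |B| := by
    rw [abs_mul, abs_neg, abs_of_nonneg (by positivity)]
    gcongr
    linarith
  have hlast : |((z / (2 * angT t)) ^ 2 - 1 / (2 * angT t)) * φ| ≤
      (1 / angT t + z ^ 2 / angT t ^ 2) * (E * q * N) := by
    rw [abs_mul]
    refine (mul_le_mul hcoef hphi (abs_nonneg _) (by positivity)).trans (le_of_eq ?_)
    ring
  calc _ ≤ thw t lam z * angR x y ^ (a + b) *
        (|A| + z / angT t * |B| + (1 / angT t + z ^ 2 / angT t ^ 2) * (E * q * N)) := by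
        refine mul_le_mul_of_nonneg_left ?_ hK
        exact (abs_add_le _ _).trans (add_le_add ((abs_add_le _ _).trans (by gcongr)) hlast)
    _ = _ := by ring
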